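/- Let $f : \mathcal{P}(\mathbb{R}^d) \to \mathbb{R}$ be convex in law, bounded from below, and lower semicontinuous with respect to weak convergence. Let $(\Omega, \mathcal{F}, \mathbb{P})$ be a probability space and $\beta : [0,1] \times \Omega \to \mathbb{R}^d$ jointly measurable with $\int_\Omega \int_0^1 |\beta_t(\omega)|\, dt\, \mathbb{P}(d\omega) < \infty$. Then for every $n \in \mathbb{N}$: $\int_0^1 f(\mathcal{L}(\beta_t))\, dt \ \ge\ 2^{-n} \sum_{i=0}^{2^n - 1} f\Bigl(\mathcal{L}\Bigl(2^n \int_{i 2^{-n}}^{(i+1) 2^{-n}} \beta_s\, ds\Bigr)\Bigr)$, where the left-hand side is well defined in $(-\infty, +\infty]$. -/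

import Mathlib

open MeasureTheory

/-- A function `f` on probability measures on `ℝ^d` is *convex in law* if for every
probability space, every pair of integrable `ℝ^d`-valued random variables `Z, W` and every
`l ∈ [0,1]`, one has `f (ℒ(l Z + (1-l) W)) ≤ l f (ℒ Z) + (1-l) f (ℒ W)`. -/
def ConvexInLaw (d : ℕ) (f : ProbabilityMeasure (Fin d → ℝ) → ℝ) : Prop :=
  ∀ (Ω : Type) (_ : MeasurableSpace Ω) (P : Measure Ω), IsProbabilityMeasure P →
    ∀ (Z W : Ω → (Fin d → ℝ)), Integrable Z P → Integrable W P →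
    ∀ l ∈ Set.Icc (0 : ℝ) 1,
    ∀ (ρZ ρW ρS : ProbabilityMeasure (Fin d → ℝ)),
      (ρZ : Measure (Fin d → ℝ)) = P.map Z →
      (ρW : Measure (Fin d → ℝ)) = P.map W →
      (ρS : Measure (Fin d → ℝ)) = P.map (fun ω => l • Z ω + (1 - l) • W ω) →
      f ρS ≤ l * f ρZ + (1 - l) * f ρW

open Filter Topology ProbabilityTheory in
lemma slln_aux {E : Type*} [NormedAddCommGroup E] [NormedSpace ℝ E] [CompleteSpace E]
    [MeasurableSpace E] [BorelSpace E] (μ : Measure ℝ) [IsProbabilityMeasure μ]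
    (h : ℝ → E) (hm : Measurable h) (hi : Integrable h μ) :
    ∀ᵐ x ∂(Measure.infinitePi (fun _ : ℕ => μ)),
      Tendsto (fun N : ℕ => (N : ℝ)⁻¹ • ∑ i ∈ Finset.range N, h (x i)) atTop
        (𝓝 (∫ t, h t ∂μ)) := by
  have mp : ∀ i, MeasurePreserving (Function.eval i : (ℕ → ℝ) → ℝ)
      (Measure.infinitePi (fun _ : ℕ => μ)) μ :=
    fun i => measurePreserving_eval_infinitePi (fun _ : ℕ => μ) i
  have hid : ∀ i, IdentDistrib (fun x : ℕ → ℝ => h (x i)) (fun x : ℕ → ℝ => h (x 0))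
      (Measure.infinitePi (fun _ : ℕ => μ)) (Measure.infinitePi (fun _ : ℕ => μ)) := by
    intro i
    have : IdentDistrib (fun x : ℕ → ℝ => x i) (fun x : ℕ → ℝ => x 0)
      (Measure.infinitePi (fun _ : ℕ => μ)) (Measure.infinitePi (fun _ : ℕ => μ)) :=
      ⟨(measurable_pi_apply i).aemeasurable, (measurable_pi_apply 0).aemeasurable,
        (mp i).map_eq.trans (mp 0).map_eq.symm⟩
    exact this.comp hm
  have h0 : Integrable (fun x : ℕ → ℝ => h (x 0)) (Measure.infinitePi (fun _ : ℕ => μ)) :=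
    (mp 0).integrable_comp_of_integrable hi
  have hind : iIndepFun (fun i (x : ℕ → ℝ) => h (x i)) (Measure.infinitePi (fun _ : ℕ => μ)) :=
    iIndepFun_infinitePi (X := fun _ => h) (fun _ => hm)
  have key := strong_law_ae (fun i (x : ℕ → ℝ) => h (x i)) h0
    (fun i j hij => hind.indepFun hij) hid
  have e : ∫ x, h (x 0) ∂(Measure.infinitePi (fun _ : ℕ => μ)) = ∫ t, h t ∂μ := by
    have e1 := integral_map (mp 0).measurable.aemeasurable (f := h)
      (by rw [(mp 0).map_eq]; exact hi.aestronglyMeasurable)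
    rw [(mp 0).map_eq] at e1
    exact e1.symm
  rw [← e]
  exact key

lemma convex_avg_aux {d : ℕ} {f : ProbabilityMeasure (Fin d → ℝ) → ℝ}
    (hconv : ConvexInLaw d f) {Ω : Type} [MeasurableSpace Ω] (P : Measure Ω)
    [IsProbabilityMeasure P] (Z : ℕ → Ω → (Fin d → ℝ)) (hZ : ∀ i, Integrable (Z i) P)
    (ρ : ℕ → ProbabilityMeasure (Fin d → ℝ))
    (hρ : ∀ i, (ρ i : Measure (Fin d → ℝ)) = P.map (Z i)) (N : ℕ)
    (S : ProbabilityMeasure (Fin d → ℝ))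
    (hS : (S : Measure (Fin d → ℝ)) =
      P.map (fun ω => ((N + 1 : ℕ) : ℝ)⁻¹ • ∑ i ∈ Finset.range (N + 1), Z i ω)) :
    f S ≤ ((N + 1 : ℕ) : ℝ)⁻¹ * ∑ i ∈ Finset.range (N + 1), f (ρ i) := by
  induction N generalizing S with
  | zero =>
    have : S = ρ 0 := by
      apply Subtype.ext
      refine hS.trans (Eq.trans ?_ (hρ 0).symm)
      simp
    simp [this]
  | succ N ih =>
    have hA : Integrable
        (fun ω => ((N + 1 : ℕ) : ℝ)⁻¹ • ∑ i ∈ Finset.range (N + 1), Z i ω) P :=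
      (integrable_finsetSum (Finset.range (N + 1)) (fun i _ => hZ i)).smul
        (((N + 1 : ℕ) : ℝ)⁻¹)
    let A : ProbabilityMeasure (Fin d → ℝ) :=
      ⟨P.map (fun ω => ((N + 1 : ℕ) : ℝ)⁻¹ • ∑ i ∈ Finset.range (N + 1), Z i ω),
        Measure.isProbabilityMeasure_map hA.aemeasurable⟩
    have h1 := ih A rfl
    have hN : (0 : ℝ) < N + 1 := by positivity
    have hN2 : (0 : ℝ) < N + 1 + 1 := by positivity
    have h2 := hconv Ω _ P inferInstance _ _ hA (hZ (N + 1)) (((N : ℝ) + 1) / (N + 1 + 1))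
      ⟨by positivity, by rw [div_le_one hN2]; linarith⟩ A (ρ (N + 1)) S rfl (hρ _) (by
        rw [hS]
        congr 1
        funext ω
        rw [Finset.sum_range_succ _ (N + 1), smul_add, smul_smul]
        push_cast
        congr 2
        · field_simp
        · field_simp
          ring)
    refine h2.trans ?_
    rw [Finset.sum_range_succ _ (N + 1)]
    have h3 := mul_le_mul_of_nonneg_left h1 (show 0 ≤ ((N : ℝ) + 1) / (N + 1 + 1) by positivity)
    refine (add_le_add_left h3 _).trans (le_of_eq ?_)
    push_cast
    field_simp
    ring

open Filter Topology in
lemma jensen_aux {d : ℕ} {f : ProbabilityMeasure (Fin d → ℝ) → ℝ}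
    (hconv : ConvexInLaw d f) (hlsc : LowerSemicontinuous f)
    {Ω : Type} [MeasurableSpace Ω] (P : Measure Ω) [IsProbabilityMeasure P]
    (β : ℝ → Ω → (Fin d → ℝ)) (hβmeas : Measurable (Function.uncurry β))
    (μ : Measure ℝ) [IsProbabilityMeasure μ]
    (hβint : Integrable (fun p : ℝ × Ω => β p.1 p.2) (μ.prod P))
    (L : ℝ → ProbabilityMeasure (Fin d → ℝ))
    (hL : ∀ t : ℝ, (L t : Measure (Fin d → ℝ)) = P.map (β t))
    (hf : Integrable (fun t => f (L t)) μ)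
    (ρ : ProbabilityMeasure (Fin d → ℝ))
    (hρ : (ρ : Measure (Fin d → ℝ)) = P.map (fun ω => ∫ s, β s ω ∂μ)) :
    f ρ ≤ ∫ t, f (L t) ∂μ := by
  have mp : ∀ i, MeasurePreserving (Function.eval i : (ℕ → ℝ) → ℝ)
      (Measure.infinitePi (fun _ : ℕ => μ)) μ :=
    fun i => measurePreserving_eval_infinitePi (fun _ : ℕ => μ) i
  have hβt : ∀ t, Measurable (β t) := fun t => hβmeas.comp measurable_prodMk_left
  have hβω : ∀ ω, Measurable (fun t => β t ω) := fun ω => hβmeas.comp measurable_prodMk_right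
  have hlim : Measurable (fun ω => ∫ s, β s ω ∂μ) :=
    (hβmeas.stronglyMeasurable.integral_prod_left' (μ := μ)).measurable
  -- integrability along the samples
  have h1 : ∀ᵐ x ∂(Measure.infinitePi (fun _ : ℕ => μ)), ∀ i, Integrable (β (x i)) P := by
    rw [ae_all_iff]
    intro i
    exact (mp i).quasiMeasurePreserving.ae hβint.prod_right_ae
  -- convergence of the costs
  have h2 : ∀ᵐ x ∂(Measure.infinitePi (fun _ : ℕ => μ)),
      Tendsto (fun N : ℕ => (N : ℝ)⁻¹ • ∑ i ∈ Finset.range N, f (L (x i))) atTop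
        (𝓝 (∫ t, f (L t) ∂μ)) := by
    have hae := hf.aestronglyMeasurable.ae_eq_mk
    have k1 := slln_aux μ _ hf.aestronglyMeasurable.stronglyMeasurable_mk.measurable
      (hf.congr hae)
    have k2 : ∀ᵐ x ∂(Measure.infinitePi (fun _ : ℕ => μ)), ∀ i,
        f (L (x i)) = hf.aestronglyMeasurable.mk _ (x i) := by
      rw [ae_all_iff]
      intro i
      exact (mp i).quasiMeasurePreserving.ae hae
    filter_upwards [k1, k2] with x hx1 hx2
    rw [integral_congr_ae hae]
    simpa only [hx2] using hx1
  -- convergence of the averages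
  have h3 : ∀ᵐ x ∂(Measure.infinitePi (fun _ : ℕ => μ)), ∀ᵐ ω ∂P,
      Tendsto (fun N : ℕ => (N : ℝ)⁻¹ • ∑ i ∈ Finset.range N, β (x i) ω) atTop
        (𝓝 (∫ t, β t ω ∂μ)) := by
    rw [Measure.ae_ae_comm]
    · filter_upwards [hβint.prod_left_ae] with ω hω
      exact slln_aux μ (fun t => β t ω) (hβω ω) hω
    · apply measurableSet_tendsto_fun
      · intro N
        refine Measurable.const_smul (g := fun z : (ℕ → ℝ) × Ω =>
          ∑ i ∈ Finset.range N, β (z.1 i) z.2) ?_ ((N : ℝ)⁻¹)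
        refine Finset.measurable_fun_sum _ fun i _ => ?_
        have hm : Measurable (fun z : (ℕ → ℝ) × Ω => (z.1 i, z.2)) := by fun_prop
        exact hβmeas.comp hm
      · exact hlim.comp measurable_snd
  obtain ⟨x, hx1, hx2, hx3⟩ := (h1.and (h2.and h3)).exists
  have hX : ∀ N : ℕ, AEMeasurable
      (fun ω => (N : ℝ)⁻¹ • ∑ i ∈ Finset.range N, β (x i) ω) P := fun N =>
    ((integrable_finsetSum _ (fun i _ => hx1 i)).smul ((N : ℝ)⁻¹)).aemeasurable
  have hdist := (tendstoInMeasure_of_tendsto_ae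
    (fun N => (hX N).aestronglyMeasurable) hx3).tendstoInDistribution hX
  have hT := hdist.tendsto
  have hρ' : ρ = ⟨P.map (fun ω => ∫ s, β s ω ∂μ),
      Measure.isProbabilityMeasure_map hdist.aemeasurable_limit⟩ := Subtype.ext hρ
  rw [← hρ'] at hT
  by_contra! hlt
  obtain ⟨c, hc1, hc2⟩ := exists_between hlt
  have e1 := hT.eventually (hlsc ρ c hc2)
  have e2 := hx2.eventually (gt_mem_nhds hc1)
  obtain ⟨N, ⟨hN1, hN2⟩, hN3⟩ := ((e1.and e2).and (eventually_ge_atTop 1)).exists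
  obtain ⟨M, rfl⟩ : ∃ M, N = M + 1 := ⟨N - 1, by omega⟩
  have := convex_avg_aux hconv P (fun i => β (x i)) hx1 (fun i => L (x i)) (fun i => hL _) M
    ⟨_, Measure.isProbabilityMeasure_map (hX (M + 1))⟩ rfl |>.trans_lt hN2
  exact absurd (hN1.trans this) (lt_irrefl _)

/-- Lower bound relating the continuous-time cost to its `n`-th dyadic
discretization: for `f` convex in law, bounded below and weakly lower semicontinuous, and
`β : [0,1] × Ω → ℝ^d` jointly measurable and integrable,
`∫₀¹ f (ℒ(β_t)) dt ≥ 2⁻ⁿ ∑_{i<2ⁿ} f (ℒ(2ⁿ ∫_{i2⁻ⁿ}^{(i+1)2⁻ⁿ} β_s ds))`, the left-hand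
side being well defined in `(-∞, +∞]` (either `t ↦ f (ℒ(β_t))` fails to be integrable on
`[0,1]`, in which case the left-hand side is `+∞`, or the inequality holds with the real
integral). -/
theorem stmt_14 (d : ℕ) (f : ProbabilityMeasure (Fin d → ℝ) → ℝ)
    (hconv : ConvexInLaw d f)
    (hbdd : BddBelow (Set.range f))
    (hlsc : LowerSemicontinuous f)
    (Ω : Type) [MeasurableSpace Ω] (P : Measure Ω) [IsProbabilityMeasure P]
    (β : ℝ → Ω → (Fin d → ℝ))
    (hβmeas : Measurable (Function.uncurry β))
    (hβint : Integrable (fun p : ℝ × Ω => β p.1 p.2)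
      ((volume.restrict (Set.Icc (0 : ℝ) 1)).prod P))
    (L : ℝ → ProbabilityMeasure (Fin d → ℝ))
    (hL : ∀ t : ℝ, (L t : Measure (Fin d → ℝ)) = P.map (β t))
    (n : ℕ)
    (ρ : Fin (2 ^ n) → ProbabilityMeasure (Fin d → ℝ))
    (hρ : ∀ i : Fin (2 ^ n), (ρ i : Measure (Fin d → ℝ)) =
      P.map (fun ω => (2 : ℝ) ^ n •
        ∫ s in Set.Icc ((i : ℝ) / 2 ^ n) (((i : ℝ) + 1) / 2 ^ n), β s ω)) :
    ¬ IntegrableOn (fun t => f (L t)) (Set.Icc (0 : ℝ) 1) volume ∨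
      ((2 : ℝ) ^ n)⁻¹ * ∑ i, f (ρ i) ≤ ∫ t in Set.Icc (0 : ℝ) 1, f (L t) := by
  by_cases hint : IntegrableOn (fun t => f (L t)) (Set.Icc (0 : ℝ) 1) volume
  swap
  · exact Or.inl hint
  right
  have hp : (0 : ℝ) < 2 ^ n := by positivity
  have hsub : ∀ i : ℕ, i < 2 ^ n →
      Set.Icc ((i : ℝ) / 2 ^ n) (((i : ℝ) + 1) / 2 ^ n) ⊆ Set.Icc 0 1 := by
    intro i hi
    apply Set.Icc_subset_Icc
    · positivity
    · rw [div_le_one hp]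
      exact_mod_cast hi
  have key : ∀ i : Fin (2 ^ n), ((2 : ℝ) ^ n)⁻¹ * f (ρ i) ≤
      ∫ t in Set.Icc ((i : ℝ) / 2 ^ n) (((i : ℝ) + 1) / 2 ^ n), f (L t) := by
    intro i
    set I := Set.Icc ((i : ℝ) / 2 ^ n) (((i : ℝ) + 1) / 2 ^ n) with hI
    have hle : volume.restrict I ≤ volume.restrict (Set.Icc (0 : ℝ) 1) :=
      Measure.restrict_mono_set _ (hsub i i.2)
    let c : ENNReal := ENNReal.ofReal (2 ^ n)
    have hc : c ≠ ⊤ := ENNReal.ofReal_ne_top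
    have hct : c.toReal = 2 ^ n := ENNReal.toReal_ofReal hp.le
    have hprob : IsProbabilityMeasure (c • volume.restrict I) := by
      constructor
      rw [Measure.smul_apply, Measure.restrict_apply_univ, hI, Real.volume_Icc, smul_eq_mul,
        ← ENNReal.ofReal_mul hp.le, ← ENNReal.ofReal_one]
      congr 1
      field_simp
      ring
    have hb : Integrable (fun p : ℝ × Ω => β p.1 p.2) ((c • volume.restrict I).prod P) := by
      rw [Measure.prod_smul_left]
      exact (hβint.mono_measure (Measure.prod_mono hle le_rfl)).smul_measure hc
    have hg : Integrable (fun t => f (L t)) (c • volume.restrict I) :=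
      (Integrable.mono_measure hint hle).smul_measure hc
    have := jensen_aux hconv hlsc P β hβmeas (c • volume.restrict I) hb L hL hg (ρ i) (by
      rw [hρ i]
      simp only [integral_smul_measure, hct]
      rfl)
    rw [integral_smul_measure, hct, smul_eq_mul] at this
    rw [inv_mul_le_iff₀ hp]
    exact this
  rw [Finset.mul_sum]
  refine (Finset.sum_le_sum fun i _ => key i).trans (le_of_eq ?_)
  rw [Fin.sum_univ_eq_sum_range (fun i : ℕ =>
    ∫ t in Set.Icc ((i : ℝ) / 2 ^ n) (((i : ℝ) + 1) / 2 ^ n), f (L t)) (2 ^ n)]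
  have hle1 : ∀ i : ℕ, (i : ℝ) / 2 ^ n ≤ ((i : ℝ) + 1) / 2 ^ n := fun i => by
    gcongr; linarith
  have hadj := intervalIntegral.sum_integral_adjacent_intervals (μ := volume)
    (f := fun t => f (L t)) (a := fun k : ℕ => (k : ℝ) / 2 ^ n) (n := 2 ^ n) (by
      intro k hk
      push_cast
      rw [intervalIntegrable_iff_integrableOn_Icc_of_le (hle1 k)]
      exact hint.mono_set (hsub k hk))
  have hz : ((2 ^ n : ℕ) : ℝ) / 2 ^ n = 1 := by push_cast; exact div_self hp.ne'
  rw [hz, Nat.cast_zero, zero_div, intervalIntegral.integral_of_le zero_le_one,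
    ← integral_Icc_eq_integral_Ioc] at hadj
  rw [← hadj]
  refine Finset.sum_congr rfl fun i _ => ?_
  push_cast
  rw [intervalIntegral.integral_of_le (hle1 i), ← integral_Icc_eq_integral_Ioc]
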